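/- The classical Gauss sum G(n) = Σ_{k=0}^{n-1} e^{2πi k²/n} satisfies: G(n) = (1+i)√n if n ≡ 0 mod 4, G(n) = √n if n ≡ 1 mod 4, G(n) = 0 if n ≡ 2 mod 4, and G(n) = i√n if n ≡ 3 mod 4. -/

import Mathlib

open Filter Topology in
lemma gs_cpow_mul (x : ℝ) (hx : 0 < x) (z : ℂ) (hz : z ≠ 0) :
    ((x : ℂ) * z) ^ (1 / 2 : ℂ) = (x : ℂ) ^ (1 / 2 : ℂ) * z ^ (1 / 2 : ℂ) := by
  have hx' : (x : ℂ) ≠ 0 := by exact_mod_cast hx.ne'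
  rw [Complex.cpow_def_of_ne_zero (mul_ne_zero hx' hz), Complex.cpow_def_of_ne_zero hx',
    Complex.cpow_def_of_ne_zero hz, Complex.log_ofReal_mul hx hz, add_mul, Complex.exp_add,
    Complex.ofReal_log hx.le]

lemma gs_summable (T : ℝ) (hT : 0 < T) :
    Summable (fun k : ℤ => Real.exp (-Real.pi * (T * k ^ 2))) := by
  simpa using summable_pow_mul_jacobiTheta₂_term_bound 0 hT 0

open Filter Topology in
/-- A tail estimate: theta tends to one. -/
lemma gs_theta_tendsto {α : Type*} {F : Filter α} (w : α → ℂ) (c x : ℝ) (hc : 0 < c)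
    (hw : Tendsto (fun t => (w t).re) F atTop) :
    Tendsto (fun t => ∑' k : ℤ, Complex.exp (-Real.pi * (c * w t) * k ^ 2 +
      2 * Real.pi * Complex.I * (x * k))) F (𝓝 1) := by
  have hnorm : ∀ t (k : ℤ), ‖Complex.exp (-Real.pi * (c * w t) * k ^ 2 +
      2 * Real.pi * Complex.I * (x * k))‖ = Real.exp (-Real.pi * ((c * (w t).re) * k ^ 2)) := by
    intro t k
    rw [Complex.norm_exp]
    congr 1
    have : (-Real.pi * (c * w t) * k ^ 2 + 2 * Real.pi * Complex.I * (x * k) : ℂ)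
      = ((-Real.pi * c * k ^ 2 : ℝ) : ℂ) * w t + ((2 * Real.pi * (x * k) : ℝ) : ℂ) * Complex.I := by
      push_cast; ring
    rw [this, Complex.add_re, Complex.re_ofReal_mul, Complex.re_ofReal_mul]
    simp; ring
  have h := tendsto_tsum_of_dominated_convergence (𝓕 := F)
    (f := fun t (k : ℤ) => Complex.exp (-Real.pi * (c * w t) * k ^ 2 +
      2 * Real.pi * Complex.I * (x * k))) (g := fun k : ℤ => if k = 0 then (1 : ℂ) else 0)
    (gs_summable c hc) ?_ ?_
  · simpa using h
  · intro k
    by_cases hk : k = 0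
    · simpa [hk] using tendsto_const_nhds
    · simp only [hk, if_false]
      rw [tendsto_zero_iff_norm_tendsto_zero]
      simp only [hnorm]
      refine Real.tendsto_exp_atBot.comp ?_
      have hk2 : (0 : ℝ) < k ^ 2 := by positivity
      have : Tendsto (fun t => (-Real.pi * c * k ^ 2) * (w t).re) F atBot :=
        hw.const_mul_atTop_of_neg (by have := Real.pi_pos; have := mul_pos (mul_pos this hc) hk2; linarith)
      refine this.congr fun t => by ring
  · filter_upwards [hw.eventually_ge_atTop 1] with t ht k
    rw [hnorm]
    apply Real.exp_le_exp.mpr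
    have : c * (k : ℝ) ^ 2 ≤ c * (w t).re * k ^ 2 := by
      have : 0 ≤ c * (k : ℝ) ^ 2 := by positivity
      nlinarith
    have := Real.pi_pos
    nlinarith

lemma gs_inv_re (w : ℂ) (hw : 0 < w.re) : 0 < (w⁻¹).re := by
  rw [Complex.inv_re]
  exact div_pos hw (Complex.normSq_pos.mpr (by rintro rfl; simp at hw))

/-- Poisson summation on a residue class. -/
lemma gs_poisson (n : ℕ) (hn : 0 < n) (r : ℕ) (w : ℂ) (hw : 0 < w.re) :
    (w⁻¹) ^ (1 / 2 : ℂ) * ∑' k : ℤ, Complex.exp (-Real.pi * w⁻¹ * ((k : ℂ) * n + r) ^ 2) =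
    1 / n * ∑' k : ℤ, Complex.exp (-Real.pi * (((1 / n ^ 2 : ℝ) : ℂ) * w) * k ^ 2 +
      2 * Real.pi * Complex.I * (((r / n : ℝ) : ℂ) * k)) := by
  have hw0 : w ≠ 0 := by rintro rfl; simp at hw
  have hnR : (0 : ℝ) < n := by exact_mod_cast hn
  have hnC : (n : ℂ) ≠ 0 := by exact_mod_cast hn.ne'
  have hre : 0 < ((((n : ℝ) ^ 2 : ℝ) : ℂ) * w⁻¹).re := by
    rw [Complex.re_ofReal_mul]; exact mul_pos (by positivity) (gs_inv_re w hw)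
  have key := Complex.tsum_exp_neg_quadratic hre (-(w⁻¹ * n * r))
  have hp : ((((n : ℝ) ^ 2 : ℝ) : ℂ)) ^ (1 / 2 : ℂ) = n := by
    have := Complex.sq_cpow_two_inv (x := (n : ℂ)) (by simpa using hn)
    rw [← this]; push_cast; norm_num
  have hwp : (w⁻¹) ^ (1 / 2 : ℂ) ≠ 0 := by
    rw [Ne, Complex.cpow_eq_zero_iff]; simp [hw0]
  rw [gs_cpow_mul _ (by positivity) _ (inv_ne_zero hw0), hp] at key
  have e1 : ∀ k : ℤ, Complex.exp (-Real.pi * w⁻¹ * ((k : ℂ) * n + r) ^ 2) =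
      Complex.exp (-Real.pi * w⁻¹ * r ^ 2) *
      Complex.exp (-Real.pi * ((((n : ℝ) ^ 2 : ℝ) : ℂ) * w⁻¹) * k ^ 2 +
        2 * Real.pi * (-(w⁻¹ * n * r)) * k) := by
    intro k
    rw [← Complex.exp_add]; congr 1; push_cast; ring
  have e2 : ∀ k : ℤ, Complex.exp (-Real.pi / ((((n : ℝ) ^ 2 : ℝ) : ℂ) * w⁻¹) *
      (k + Complex.I * (-(w⁻¹ * n * r))) ^ 2) = Complex.exp (Real.pi * w⁻¹ * r ^ 2) *
      Complex.exp (-Real.pi * (((1 / n ^ 2 : ℝ) : ℂ) * w) * k ^ 2 +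
      2 * Real.pi * Complex.I * (((r / n : ℝ) : ℂ) * k)) := by
    intro k
    rw [← Complex.exp_add]; congr 1; push_cast; field_simp; ring_nf
    rw [Complex.I_sq]; ring
  simp_rw [e1]
  rw [tsum_mul_left, key]
  simp_rw [e2]
  rw [tsum_mul_left]
  have e3 : Complex.exp (-Real.pi * w⁻¹ * r ^ 2) * Complex.exp (Real.pi * w⁻¹ * r ^ 2) = 1 := by
    rw [← Complex.exp_add, ← Complex.exp_zero]; congr 1; ring
  generalize (∑' k : ℤ, Complex.exp (-Real.pi * (((1 / n ^ 2 : ℝ) : ℂ) * w) * k ^ 2 +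
      2 * Real.pi * Complex.I * (((r / n : ℝ) : ℂ) * k))) = S
  generalize (w⁻¹) ^ (1 / 2 : ℂ) = p at *
  calc _ = (p / p) * (Complex.exp (-Real.pi * w⁻¹ * r ^ 2) * Complex.exp (Real.pi * w⁻¹ * r ^ 2)) * (1 / n * S) := by
        field_simp
    _ = _ := by rw [e3, div_self hwp]; ring

lemma gs_split (n : ℕ) (hn : 0 < n) (g : ℤ → ℂ) (hg : ∀ q : ℤ, ∀ r : ℕ, g (q * n + r) = g r)
    (w : ℂ) (hw : 0 < w.re) :
    ∑' k : ℤ, g k * Complex.exp (-Real.pi * w⁻¹ * (k : ℂ) ^ 2) =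
    ∑ r ∈ Finset.range n, g r * ∑' k : ℤ, Complex.exp (-Real.pi * w⁻¹ * ((k : ℂ) * n + r) ^ 2) := by
  have : NeZero n := ⟨hn.ne'⟩
  have hb : ∀ k, ‖g k‖ ≤ ∑ r ∈ Finset.range n, ‖g r‖ := by
    intro k
    obtain ⟨⟨q, r⟩, rfl⟩ := (Int.divModEquiv n).symm.surjective k
    rw [Int.divModEquiv_symm_apply]
    simp only
    rw [hg]
    exact Finset.single_le_sum (f := fun r : ℕ => ‖g r‖) (fun _ _ => norm_nonneg _) (by simp)
  have hs : Summable (fun k : ℤ => g k * Complex.exp (-Real.pi * w⁻¹ * (k : ℂ) ^ 2)) := by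
    refine Summable.of_norm_bounded
      ((gs_summable _ (gs_inv_re w hw)).mul_left (∑ r ∈ Finset.range n, ‖g r‖)) ?_
    intro k
    rw [norm_mul]
    refine mul_le_mul (hb k) (le_of_eq ?_) (norm_nonneg _) (Finset.sum_nonneg fun _ _ => norm_nonneg _)
    rw [Complex.norm_exp]
    congr 1
    have : (-Real.pi * w⁻¹ * (k : ℂ) ^ 2) = ((-Real.pi * k ^ 2 : ℝ) : ℂ) * w⁻¹ := by push_cast; ring
    rw [this, Complex.re_ofReal_mul]; ring
  have hs' := (Int.divModEquiv n).symm.summable_iff.mpr hs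
  rw [← (Int.divModEquiv n).symm.tsum_eq, ← (Equiv.prodComm _ _).tsum_eq]
  have hs'' := (Equiv.prodComm (Fin n) ℤ).summable_iff.mpr hs'
  refine (hs''.tsum_prod).trans ?_
  rw [tsum_fintype, Finset.sum_range]
  refine Finset.sum_congr rfl fun r _ => ?_
  rw [← tsum_mul_left]
  refine tsum_congr fun k => ?_
  simp [Int.divModEquiv_symm_apply, hg]

open Filter Topology in
lemma gs_main {α : Type*} {F : Filter α} (n : ℕ) (hn : 0 < n) (g : ℤ → ℂ)
    (hg : ∀ q : ℤ, ∀ r : ℕ, g (q * n + r) = g r) (w : α → ℂ)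
    (hw : Tendsto (fun t => (w t).re) F atTop) :
    Tendsto (fun t => ((w t)⁻¹) ^ (1 / 2 : ℂ) *
      ∑' k : ℤ, g k * Complex.exp (-Real.pi * (w t)⁻¹ * (k : ℂ) ^ 2)) F
      (𝓝 ((∑ r ∈ Finset.range n, g r) / n)) := by
  have h : Tendsto (fun t => ∑ r ∈ Finset.range n, g r * (1 / n *
      ∑' k : ℤ, Complex.exp (-Real.pi * (((1 / n ^ 2 : ℝ) : ℂ) * w t) * k ^ 2 +
      2 * Real.pi * Complex.I * (((r / n : ℝ) : ℂ) * k)))) F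
      (𝓝 (∑ r ∈ Finset.range n, g r * (1 / n * 1))) :=
    tendsto_finsetSum _ fun r _ =>
      ((gs_theta_tendsto w (1 / n ^ 2) (r / n) (by positivity) hw).const_mul _).const_mul _
  have e : (∑ r ∈ Finset.range n, g r * (1 / n * 1)) = (∑ r ∈ Finset.range n, g r) / n := by
    rw [Finset.sum_div]; refine Finset.sum_congr rfl fun r _ => by ring
  rw [e] at h
  refine h.congr' ?_
  filter_upwards [hw.eventually_gt_atTop 0] with t ht
  rw [gs_split n hn g hg _ ht, Finset.mul_sum]
  refine Finset.sum_congr rfl fun r _ => ?_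
  rw [← gs_poisson n hn r _ ht]; ring

open Filter Topology Complex in
lemma gs_formula (n : ℕ) (hn : 0 < n) :
    ∑ k ∈ Finset.range n, Complex.exp (2 * Real.pi * I * (k : ℂ)^2 / n) =
      Real.sqrt n * ((1 + I) / 2) * (1 + (-I) ^ n) := by
  have hnR : (0 : ℝ) < n := by exact_mod_cast hn
  have hnC : (n : ℂ) ≠ 0 := by exact_mod_cast hn.ne'
  set g : ℤ → ℂ := fun k => Complex.exp (2 * Real.pi * I * (k : ℂ)^2 / n) with hgdef
  have hg : ∀ q : ℤ, ∀ r : ℕ, g (q * n + r) = g r := by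
    intro q r
    simp only [hgdef]
    rw [Complex.exp_eq_exp_iff_exists_int]
    refine ⟨q ^ 2 * n + 2 * q * r, ?_⟩
    push_cast; field_simp; ring
  set h : ℤ → ℂ := fun k => Complex.exp (-(Real.pi * I * n * (k : ℂ)^2 / 2)) with hhdef
  have hh : ∀ q : ℤ, ∀ r : ℕ, h (q * (2 : ℕ) + r) = h r := by
    intro q r
    simp only [hhdef]
    rw [Complex.exp_eq_exp_iff_exists_int]
    refine ⟨-(n * (q ^ 2 + q * r)), ?_⟩
    push_cast; ring
  have hh1 : h 1 = (-I) ^ n := by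
    have : Complex.exp (-(Real.pi / 2 * I)) = -I := by
      rw [Complex.exp_neg, Complex.exp_pi_div_two_mul_I, Complex.inv_I]
    rw [← this, ← Complex.exp_nat_mul]; simp only [hhdef]; congr 1; push_cast; ring
  have hh0 : h 0 = 1 := by simp [hhdef]
  let w2 : ℝ → ℂ := fun u => ((4 * u / n ^ 2 : ℝ) : ℂ) + ((2 / n : ℝ) : ℂ) * I
  have hw2re : ∀ u, (w2 u).re = 4 * u / n ^ 2 := by
    intro u; simp only [w2]; rw [add_re, re_ofReal_mul, ofReal_re]; simp
  have A := gs_main (F := atTop) n hn g hg (fun u : ℝ => (u : ℂ)) (by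
    simp only [ofReal_re]; exact tendsto_id)
  have B := gs_main (F := atTop) 2 two_pos h hh w2 (by
    simp only [hw2re]
    have : Tendsto (fun u : ℝ => (4 / (n : ℝ) ^ 2) * u) atTop atTop :=
      tendsto_id.const_mul_atTop (by positivity)
    exact this.congr fun u => by ring)
  let c : ℝ → ℂ := fun u => (u : ℂ)⁻¹ - ((2 / n : ℝ) : ℂ) * I
  have hinv : Tendsto (fun u : ℝ => (u : ℂ)⁻¹) atTop (𝓝 0) := by
    have := (continuous_ofReal.tendsto 0).comp tendsto_inv_atTop_zero (α := ℝ)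
    refine (this.congr fun u => by simp).trans (by simp)
  have hc : Tendsto c atTop (𝓝 (-((2 / n : ℝ) : ℂ) * I)) := by
    have := hinv.sub_const (((2 / n : ℝ) : ℂ) * I)
    simpa [c] using this
  have hsq : (-((2 / n : ℝ) : ℂ) * I) ^ (1 / 2 : ℂ) = (1 - I) / (Real.sqrt n : ℝ) := by
    have hs : ((Real.sqrt n : ℝ) : ℂ) ^ 2 = n := by
      rw [← ofReal_pow, Real.sq_sqrt hnR.le]; simp
    have := Complex.sq_cpow_two_inv (x := (1 - I) / (Real.sqrt n : ℝ)) (by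
      rw [div_ofReal_re]; simp; exact hn)
    rw [← this, one_div]; congr 1
    rw [div_pow, hs]
    push_cast
    have : (1 - I) ^ 2 = -2 * I := by ring_nf; rw [I_sq]; ring
    rw [this]; ring
  have hcp : Tendsto (fun u => c u ^ (1 / 2 : ℂ)) atTop (𝓝 ((1 - I) / (Real.sqrt n : ℝ))) := by
    rw [← hsq]
    refine hc.cpow tendsto_const_nhds ?_
    right
    simp [hn.ne']
  have hv : Tendsto (fun u : ℝ => ((u : ℂ) * (w2 u)⁻¹) ^ (1 / 2 : ℂ)) atTop (𝓝 (n / 2)) := by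
    have h1 : Tendsto (fun u : ℝ => ((4 / n ^ 2 : ℝ) : ℂ) + (u : ℂ)⁻¹ * (((2 / n : ℝ) : ℂ) * I)) atTop
        (𝓝 (((4 / n ^ 2 : ℝ) : ℂ))) := by
      have := (hinv.mul_const (((2 / n : ℝ) : ℂ) * I)).const_add ((4 / n ^ 2 : ℝ) : ℂ)
      rwa [zero_mul, add_zero] at this
    have h2 := h1.inv₀ (by
      rw [Ne, ofReal_eq_zero]; positivity)
    have h3 : Tendsto (fun u : ℝ => (u : ℂ) * (w2 u)⁻¹) atTop (𝓝 ((((4 / n ^ 2 : ℝ) : ℂ))⁻¹)) := by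
      refine h2.congr' ?_
      filter_upwards [eventually_gt_atTop 0] with u hu
      have hu' : (u : ℂ) ≠ 0 := by exact_mod_cast hu.ne'
      have : w2 u = u * (((4 / n ^ 2 : ℝ) : ℂ) + (u : ℂ)⁻¹ * (((2 / n : ℝ) : ℂ) * I)) := by
        simp only [w2]; push_cast; field_simp
      rw [this, mul_inv, mul_inv_cancel_left₀ hu']
    have e : (((4 / n ^ 2 : ℝ) : ℂ))⁻¹ = ((n : ℂ) / 2) ^ 2 := by
      push_cast; field_simp; norm_num
    rw [e] at h3
    have := h3.cpow (tendsto_const_nhds (x := (1 / 2 : ℂ))) (by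
      left
      have : ((n : ℂ) / 2) ^ 2 = (((n : ℝ) / 2) ^ 2 : ℝ) := by push_cast; ring
      rw [this, ofReal_re]; positivity)
    have e2 := Complex.sq_cpow_two_inv (x := (n : ℂ) / 2) (by simpa using hn)
    rw [one_div] at this ⊢
    rwa [e2] at this
  -- the exact identity
  have hid : ∀ᶠ u : ℝ in atTop, c u ^ (1 / 2 : ℂ) * ((u : ℂ) * (w2 u)⁻¹) ^ (1 / 2 : ℂ) *
      (((u : ℂ)⁻¹) ^ (1 / 2 : ℂ) * ∑' k : ℤ, g k * Complex.exp (-Real.pi * (u : ℂ)⁻¹ * (k : ℂ) ^ 2))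
      = ((w2 u)⁻¹) ^ (1 / 2 : ℂ) *
      ∑' k : ℤ, h k * Complex.exp (-Real.pi * (w2 u)⁻¹ * (k : ℂ) ^ 2) := by
    filter_upwards [eventually_gt_atTop 0] with u hu
    have hu' : (u : ℂ) ≠ 0 := by exact_mod_cast hu.ne'
    have hcre : 0 < (c u).re := by
      simp only [c]; rw [sub_re, re_ofReal_mul, ← ofReal_inv, ofReal_re]; simpa using hu
    have hc0 : c u ≠ 0 := by intro h; simp [h] at hcre
    have hw0 : w2 u ≠ 0 := by
      intro h
      have := hw2re u
      rw [h, zero_re] at this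
      have : 0 < 4 * u / (n : ℝ) ^ 2 := by positivity
      linarith
    have P := Complex.tsum_exp_neg_mul_int_sq hcre
    have hcp0 : (c u) ^ (1 / 2 : ℂ) ≠ 0 := by
      rw [Ne, Complex.cpow_eq_zero_iff]; simp [hc0]
    have s1 : ∀ k : ℤ, g k * Complex.exp (-Real.pi * (u : ℂ)⁻¹ * (k : ℂ) ^ 2) =
        Complex.exp (-Real.pi * c u * (k : ℂ) ^ 2) := by
      intro k
      simp only [hgdef, c]; rw [← Complex.exp_add]; congr 1; push_cast; ring
    have hrel : (c u)⁻¹ = n * I / 2 + (w2 u)⁻¹ := by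
      have e1 : c u * (u * n) = n - 2 * u * I := by
        simp only [c]; push_cast; field_simp
      have e2 : w2 u * n ^ 2 = 4 * u + 2 * n * I := by
        simp only [w2]; push_cast; field_simp
      have e3 : w2 u * n ^ 2 = 2 * I * (c u * (u * n)) := by
        rw [e1, e2]; ring_nf; rw [I_sq]; ring
      have e4 : w2 u = 2 * I * c u * u / n := by
        field_simp; apply mul_right_cancel₀ hnC; linear_combination e3
      rw [e4]
      have e1' : c u * (u * n) - n + 2 * u * I = 0 := by rw [e1]; ring
      clear_value c
      generalize c u = z at *
      have hI := I_ne_zero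
      have key : 2 * I * u = n * I ^ 2 * u * z + n := by
        linear_combination e1' - z * u * n * I_sq
      field_simp
      linear_combination key
    have s2 : ∀ k : ℤ, Complex.exp (-Real.pi / c u * (k : ℂ) ^ 2) =
        h k * Complex.exp (-Real.pi * (w2 u)⁻¹ * (k : ℂ) ^ 2) := by
      intro k
      simp only [hhdef]; rw [← Complex.exp_add, div_eq_mul_inv, hrel]; congr 1; ring
    simp_rw [s1, ← s2]
    rw [P, gs_cpow_mul u hu _ (inv_ne_zero hw0)]
    have s3 : (u : ℂ) ^ (1 / 2 : ℂ) * ((u : ℂ)⁻¹) ^ (1 / 2 : ℂ) = 1 := by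
      rw [← gs_cpow_mul u hu _ (inv_ne_zero hu'), mul_inv_cancel₀ hu', one_cpow]
    generalize (∑' k : ℤ, Complex.exp (-Real.pi / c u * (k : ℂ) ^ 2)) = S
    calc _ = ((u : ℂ) ^ (1 / 2 : ℂ) * ((u : ℂ)⁻¹) ^ (1 / 2 : ℂ)) *
          (c u ^ (1 / 2 : ℂ) * (1 / c u ^ (1 / 2 : ℂ))) * ((w2 u)⁻¹ ^ (1 / 2 : ℂ) * S) := by ring
      _ = _ := by rw [s3, mul_one_div_cancel hcp0]; ring
  have L := tendsto_nhds_unique (((hcp.mul hv).mul A).congr' hid) B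
  have hs : ((Real.sqrt n : ℝ) : ℂ) ^ 2 = n := by
    rw [← ofReal_pow, Real.sq_sqrt hnR.le]; simp
  have hs0 : ((Real.sqrt n : ℝ) : ℂ) ≠ 0 := by
    intro h; rw [h] at hs; simp at hs; exact hnC hs.symm
  have hR : ∑ r ∈ Finset.range 2, h r = 1 + (-I) ^ n := by
    rw [Finset.sum_range_succ, Finset.sum_range_one]
    rw [← hh1, ← hh0]; simp
  have hL : ∑ r ∈ Finset.range n, g r =
      ∑ k ∈ Finset.range n, Complex.exp (2 * Real.pi * I * (k : ℂ)^2 / n) := by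
    simp [hgdef]
  rw [hR, hL] at L
  generalize (∑ k ∈ Finset.range n, Complex.exp (2 * Real.pi * I * (k : ℂ)^2 / n)) = G at *
  generalize (1 + (-I) ^ n) = T at *
  have L2 : (1 - I) * G = T * (Real.sqrt n : ℝ) := by
    field_simp at L
    push_cast at L
    linear_combination L / 2
  linear_combination ((1 + I) / 2) * L2 + G / 2 * I_sq

open Complex in
/-- The classical Gauss sum G(n) = Σ_{k=0}^{n-1} e^{2πik²/n} equals
    (1+i)√n, √n, 0, i√n according as n ≡ 0,1,2,3 mod 4. -/
theorem stmt11 (n : ℕ) (hn : 0 < n) :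
    let G : ℂ := ∑ k ∈ Finset.range n, Complex.exp (2 * Real.pi * I * (k : ℂ)^2 / n)
    (n % 4 = 0 → G = (1 + I) * Real.sqrt n) ∧
    (n % 4 = 1 → G = Real.sqrt n) ∧
    (n % 4 = 2 → G = 0) ∧
    (n % 4 = 3 → G = I * Real.sqrt n) := by

  have hG := gs_formula n hn
  have hI : (-I) ^ n = (-I) ^ (n % 4) := by
    conv_lhs => rw [← Nat.div_add_mod n 4, pow_add, pow_mul]
    have : (-I) ^ 4 = 1 := by rw [neg_pow, I_pow_four]; norm_num
    rw [this, one_pow, one_mul]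
  rw [hI] at hG
  intro G
  have hG' : G = Real.sqrt n * ((1 + I) / 2) * (1 + (-I) ^ (n % 4)) := hG
  refine ⟨fun h => ?_, fun h => ?_, fun h => ?_, fun h => ?_⟩ <;> rw [hG', h]
  · ring
  · linear_combination (-(Real.sqrt n : ℂ) / 2) * I_sq
  · linear_combination ((Real.sqrt n : ℂ) * (1 + I) / 2) * I_sq
  · linear_combination (-(Real.sqrt n : ℂ) / 2 * (I ^ 2 + I - 1)) * I_sq
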